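/- arXiv:2108.00891 — 9 statements merged into one kernel-verified Lean document; each statement's English description precedes it below -/
import Mathlib

section
/- Let W be a real Banach space and h, g : W → ℝ such that for every u ∈ W with g(u) ≠ 0 the fiber maps t ↦ h(tu), t ↦ g(tu) are twice differentiable on (0,∞) with (d/dt)g(tu) ≠ 0 for all t > 0. Assume condition (S): for every such u, every critical point t₀ ∈ (0,∞) of the fibered Rayleigh quotient r_u(t) = 𝓡ⁿ(tu) = ((d/dt)h(tu))/((d/dt)g(tu)) is a point of global minimum or global maximum of r_u over (0,∞). Define λ*_min = sup_{u : g(u)≠0} inf_{t>0} r_u(t) and λ*_max = inf_{u : g(u)≠0} sup_{t>0} r_u(t), and assume −∞ ≤ λ*_min < λ*_max ≤ +∞. Then for every λ with λ*_min < λ < λ*_max and every u ∈ N_λ = {u ≠ 0 : (d/dt)(h(tu) − λg(tu))|_{t=1} = 0} with g(u) ≠ 0, one has r_u'(1) ≠ 0 and consequently f_λ''(u) := (d²/dt²)(h(tu) − λg(tu))|_{t=1} ≠ 0; i.e. (λ*_min, λ*_max) is an interval of applicability of the Nehari manifold method. -/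
/-- Lemma 2.5 (Lemma `thm1`): under condition (S), `(λ*_min, λ*_max)` is an interval of
applicability of the Nehari manifold method: for every `λ` in this interval and every
`u ∈ N_λ` with `g u ≠ 0`, the fibered Rayleigh quotient has nonzero derivative at `1`
and `f_λ''(u) ≠ 0`. -/
theorem stmt_4 {W : Type*} [NormedAddCommGroup W] [NormedSpace ℝ W] [CompleteSpace W]
    (h g : W → ℝ)
    (r : W → ℝ → ℝ)
    (hr : r = fun u t => deriv (fun s : ℝ => h (s • u)) t / deriv (fun s : ℝ => g (s • u)) t)
    (hdiff : ∀ u : W, g u ≠ 0 → ∀ t : ℝ, 0 < t →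
      DifferentiableAt ℝ (fun s : ℝ => h (s • u)) t ∧
      DifferentiableAt ℝ (fun s : ℝ => g (s • u)) t ∧
      DifferentiableAt ℝ (deriv (fun s : ℝ => h (s • u))) t ∧
      DifferentiableAt ℝ (deriv (fun s : ℝ => g (s • u))) t ∧
      deriv (fun s : ℝ => g (s • u)) t ≠ 0)
    (hS : ∀ u : W, g u ≠ 0 → ∀ t₀ : ℝ, 0 < t₀ → deriv (r u) t₀ = 0 →
      (∀ t : ℝ, 0 < t → r u t₀ ≤ r u t) ∨ (∀ t : ℝ, 0 < t → r u t ≤ r u t₀))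
    (lamMin lamMax : EReal)
    (hMin : lamMin = ⨆ u ∈ {u : W | g u ≠ 0}, ⨅ t ∈ Set.Ioi (0 : ℝ), ((r u t : ℝ) : EReal))
    (hMax : lamMax = ⨅ u ∈ {u : W | g u ≠ 0}, ⨆ t ∈ Set.Ioi (0 : ℝ), ((r u t : ℝ) : EReal))
    (hlt : lamMin < lamMax)
    (lam : ℝ) (hlam1 : lamMin < (lam : EReal)) (hlam2 : (lam : EReal) < lamMax)
    (u : W) (hu : u ≠ 0) (hgu : g u ≠ 0)
    (hNeh : deriv (fun s : ℝ => h (s • u) - lam * g (s • u)) 1 = 0) :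
    deriv (r u) 1 ≠ 0 ∧
    deriv (deriv (fun s : ℝ => h (s • u) - lam * g (s • u))) 1 ≠ 0 := by
  have hd : ∀ t : ℝ, 0 < t → deriv (fun s : ℝ => h (s • u) - lam * g (s • u)) t =
      deriv (fun s : ℝ => h (s • u)) t - lam * deriv (fun s : ℝ => g (s • u)) t := by
    intro t ht
    obtain ⟨a, b, -, -, -⟩ := hdiff u hgu t ht
    exact (a.hasDerivAt.sub (b.hasDerivAt.const_mul lam)).deriv
  obtain ⟨-, -, c, d, e⟩ := hdiff u hgu 1 one_pos
  have hH : deriv (fun s : ℝ => h (s • u)) 1 = lam * deriv (fun s : ℝ => g (s • u)) 1 := by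
    have := hd 1 one_pos
    linarith
  have hr1 : r u 1 = lam := by
    rw [hr]
    exact (div_eq_iff e).2 hH
  have h1 : deriv (r u) 1 ≠ 0 := by
    intro h0
    rcases hS u hgu 1 one_pos h0 with hm | hm
    · refine absurd hlam1 (not_lt.2 ?_)
      rw [hMin]
      refine le_trans ?_ (le_iSup₂ (f := fun (u : W) (_ : u ∈ {u : W | g u ≠ 0}) =>
        ⨅ t ∈ Set.Ioi (0 : ℝ), ((r u t : ℝ) : EReal)) u hgu)
      refine le_iInf₂ fun t ht => ?_
      rw [← hr1]
      exact EReal.coe_le_coe_iff.2 (hm t ht)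
    · refine absurd hlam2 (not_lt.2 ?_)
      rw [hMax]
      refine le_trans (iInf₂_le (f := fun (u : W) (_ : u ∈ {u : W | g u ≠ 0}) =>
        ⨆ t ∈ Set.Ioi (0 : ℝ), ((r u t : ℝ) : EReal)) u hgu) ?_
      refine iSup₂_le fun t ht => ?_
      rw [← hr1]
      exact EReal.coe_le_coe_iff.2 (hm t ht)
  refine ⟨h1, fun h2 => h1 ?_⟩
  have hev : deriv (fun s : ℝ => h (s • u) - lam * g (s • u)) =ᶠ[nhds 1]
      fun t => deriv (fun s : ℝ => h (s • u)) t - lam * deriv (fun s : ℝ => g (s • u)) t := by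
    filter_upwards [lt_mem_nhds (one_pos : (0 : ℝ) < 1)] with t ht using hd t ht
  have h3 := (c.hasDerivAt.sub (d.hasDerivAt.const_mul lam)).deriv
  have h4 := hev.deriv_eq.symm.trans h2
  have h5 := h3.symm.trans h4
  have h6 := (c.hasDerivAt.div d.hasDerivAt e).deriv
  rw [hr]
  refine h6.trans ?_
  rw [hH, div_eq_zero_iff]
  left
  linear_combination (deriv (fun s : ℝ => g (s • u)) 1) * h5
end

section
/- Let 1 < q < p < γ be real numbers and T, Q, F > 0. Define R : (0,∞) → ℝ by R(s) = (s^p·T − s^γ·F)/(s^q·Q) and set λ* = sup_{s>0} R(s). Then for every λ with 0 < λ < λ*, the fibering function Φ(s) = (s^p/p)·T − λ·(s^q/q)·Q − (s^γ/γ)·F has exactly two critical points on (0,∞), say 0 < s⁺ < s⁻, and they are nondegenerate with Φ''(s⁺) > 0 and Φ''(s⁻) < 0; i.e. s⁺ is a local minimum point and s⁻ is a local maximum point of Φ. -/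
/-- Per-fiber structure underlying Section 3: for `0 < λ < λ* = sup_{s>0} R(s)`,
the fibering function `Φ(s) = s^p/p·T − λ·s^q/q·Q − s^γ/γ·F` has exactly two critical
points `0 < s⁺ < s⁻` on `(0,∞)`, with `Φ''(s⁺) > 0` and `Φ''(s⁻) < 0`; `s⁺` is a local
minimum point and `s⁻` a local maximum point of `Φ`. -/
theorem stmt_5 (q p γ T Q F lam lamStar : ℝ)
    (hq : 1 < q) (hqp : q < p) (hpγ : p < γ)
    (hT : 0 < T) (hQ : 0 < Q) (hF : 0 < F)
    (R Φ : ℝ → ℝ)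
    (hR : R = fun s : ℝ => (s ^ p * T - s ^ γ * F) / (s ^ q * Q))
    (hΦ : Φ = fun s : ℝ => s ^ p / p * T - lam * (s ^ q / q) * Q - s ^ γ / γ * F)
    (hlamStar : lamStar = ⨆ s : Set.Ioi (0 : ℝ), R (s : ℝ))
    (hlam0 : 0 < lam) (hlam : lam < lamStar) :
    ∃ sp sm : ℝ, 0 < sp ∧ sp < sm ∧
      deriv Φ sp = 0 ∧ deriv Φ sm = 0 ∧
      (∀ s : ℝ, 0 < s → deriv Φ s = 0 → s = sp ∨ s = sm) ∧
      0 < deriv (deriv Φ) sp ∧ deriv (deriv Φ) sm < 0 ∧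
      IsLocalMin Φ sp ∧ IsLocalMax Φ sm := by
  subst hR
  have hd : 0 < γ - p := by linarith
  have hd' : γ - p ≠ 0 := hd.ne'
  have ha : 0 < p - q := by linarith
  have hb : 0 < γ - q := by linarith
  set g : ℝ → ℝ := fun s => s ^ (p - q) * T - s ^ (γ - q) * F - lam * Q with hg
  have hsplit : ∀ s : ℝ, 0 < s → s ^ (γ - q) = s ^ (p - q) * s ^ (γ - p) := by
    intro s hs
    rw [← Real.rpow_add hs]; congr 1; ring
  have hsplit1 : ∀ s : ℝ, 0 < s → s ^ (γ - q - 1) = s ^ (p - q - 1) * s ^ (γ - p) := by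
    intro s hs
    rw [← Real.rpow_add hs]; congr 1; ring
  -- derivative of g
  have hgd : ∀ s : ℝ, 0 < s → HasDerivAt g
      (s ^ (p - q - 1) * ((p - q) * T - (γ - q) * F * s ^ (γ - p))) s := by
    intro s hs
    have h1 := (Real.hasDerivAt_rpow_const (x := s) (p := p - q) (Or.inl hs.ne')).mul_const T
    have h2 := (Real.hasDerivAt_rpow_const (x := s) (p := γ - q) (Or.inl hs.ne')).mul_const F
    have h3 := (h1.sub h2).sub_const (lam * Q)
    refine h3.congr_deriv ?_
    rw [hsplit1 s hs]; ring
  have hgc : Continuous g := by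
    have h1 := Real.continuous_rpow_const ha.le
    have h2 := Real.continuous_rpow_const hb.le
    exact ((h1.mul continuous_const).sub (h2.mul continuous_const)).sub continuous_const
  -- derivative of Φ
  have hΦd : ∀ s : ℝ, 0 < s → HasDerivAt Φ (s ^ (q - 1) * g s) s := by
    intro s hs
    have h1 := ((Real.hasDerivAt_rpow_const (x := s) (p := p) (Or.inl hs.ne')).div_const p).mul_const T
    have h2 := (((Real.hasDerivAt_rpow_const (x := s) (p := q) (Or.inl hs.ne')).div_const q).const_mul
      lam).mul_const Q
    have h3 := ((Real.hasDerivAt_rpow_const (x := s) (p := γ) (Or.inl hs.ne')).div_const γ).mul_const F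
    have h4 := (h1.sub h2).sub h3
    rw [hΦ]
    refine h4.congr_deriv ?_
    have e1 : s ^ (p - 1) = s ^ (q - 1) * s ^ (p - q) := by
      rw [← Real.rpow_add hs]; congr 1; ring
    have e2 : s ^ (γ - 1) = s ^ (q - 1) * s ^ (γ - q) := by
      rw [← Real.rpow_add hs]; congr 1; ring
    have hp0 : p ≠ 0 := by linarith
    have hq0 : q ≠ 0 := by linarith
    have hγ0 : γ ≠ 0 := by linarith
    simp only [hg]
    rw [e1, e2]
    field_simp
    ring
  have hΦ0 : ∀ s : ℝ, 0 < s → (deriv Φ s = 0 ↔ g s = 0) := by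
    intro s hs
    rw [(hΦd s hs).deriv, mul_eq_zero]
    have := (Real.rpow_pos_of_pos hs (q - 1)).ne'
    tauto
  have hΦ2 : ∀ s : ℝ, 0 < s → g s = 0 → deriv (deriv Φ) s =
      s ^ (q - 1) * (s ^ (p - q - 1) * ((p - q) * T - (γ - q) * F * s ^ (γ - p))) := by
    intro s hs h0
    have he : deriv Φ =ᶠ[nhds s] fun t => t ^ (q - 1) * g t := by
      filter_upwards [lt_mem_nhds hs] with t ht
      exact (hΦd t ht).deriv
    rw [he.deriv_eq]
    have h1 := Real.hasDerivAt_rpow_const (x := s) (p := q - 1) (Or.inl hs.ne')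
    have h2 := (h1.mul (hgd s hs)).deriv
    rw [h0, mul_zero, zero_add] at h2
    exact h2
  -- the maximum point of g
  have hc0 : 0 < (p - q) * T / ((γ - q) * F) := by positivity
  set s0 : ℝ := ((p - q) * T / ((γ - q) * F)) ^ (γ - p)⁻¹ with hs0
  have hs0p : 0 < s0 := Real.rpow_pos_of_pos hc0 _
  have hs0e : s0 ^ (γ - p) = (p - q) * T / ((γ - q) * F) := Real.rpow_inv_rpow hc0.le hd'
  have hlt : ∀ s : ℝ, 0 < s → s < s0 → 0 < (p - q) * T - (γ - q) * F * s ^ (γ - p) := by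
    intro s hs h
    have := Real.rpow_lt_rpow hs.le h hd
    rw [hs0e, lt_div_iff₀ (by positivity)] at this
    linarith
  have hgt : ∀ s : ℝ, s0 < s → (p - q) * T - (γ - q) * F * s ^ (γ - p) < 0 := by
    intro s h
    have := Real.rpow_lt_rpow hs0p.le h hd
    rw [hs0e, div_lt_iff₀ (by positivity)] at this
    linarith
  have hmono : StrictMonoOn g (Set.Icc 0 s0) := by
    apply strictMonoOn_of_deriv_pos (convex_Icc 0 s0) hgc.continuousOn
    intro x hx
    rw [interior_Icc] at hx
    rw [(hgd x hx.1).deriv]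
    exact mul_pos (Real.rpow_pos_of_pos hx.1 _) (hlt x hx.1 hx.2)
  have hanti : StrictAntiOn g (Set.Ici s0) := by
    apply strictAntiOn_of_deriv_neg (convex_Ici s0) hgc.continuousOn
    intro x hx
    rw [interior_Ici] at hx
    have hx0 : 0 < x := hs0p.trans hx
    rw [(hgd x hx0).deriv]
    exact mul_neg_of_pos_of_neg (Real.rpow_pos_of_pos hx0 _) (hgt x hx)
  -- positivity of g at s0
  have hgs0 : 0 < g s0 := by
    rw [hlamStar] at hlam
    haveI : Nonempty (Set.Ioi (0 : ℝ)) := ⟨⟨1, Set.mem_Ioi.2 one_pos⟩⟩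
    obtain ⟨⟨s1, hs1⟩, h1⟩ := exists_lt_of_lt_ciSup hlam
    have hs1' : 0 < s1 := hs1
    have hg1 : 0 < g s1 := by
      have hqs := Real.rpow_pos_of_pos hs1' q
      simp only at h1
      rw [lt_div_iff₀ (by positivity)] at h1
      have e1 : s1 ^ p = s1 ^ q * s1 ^ (p - q) := by
        rw [← Real.rpow_add hs1']; congr 1; ring
      have e2 : s1 ^ γ = s1 ^ q * s1 ^ (γ - q) := by
        rw [← Real.rpow_add hs1']; congr 1; ring
      rw [e1, e2] at h1
      have : 0 < s1 ^ q * g s1 := by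
        simp only [hg]
        linarith
      exact (mul_pos_iff_of_pos_left hqs).1 this
    rcases le_total s1 s0 with h | h
    · exact hg1.trans_le (hmono.monotoneOn ⟨hs1'.le, h⟩ ⟨hs0p.le, le_rfl⟩ h)
    · exact hg1.trans_le (hanti.antitoneOn (Set.mem_Ici.2 le_rfl) (Set.mem_Ici.2 h) h)
  have hlQ : 0 < lam * Q := mul_pos hlam0 hQ
  have hg0 : g 0 < 0 := by
    simp only [hg]
    rw [Real.zero_rpow ha.ne', Real.zero_rpow hb.ne']
    linarith
  have hTF : 0 < T / F := div_pos hT hF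
  obtain ⟨M, hM, hgM⟩ : ∃ M, s0 < M ∧ g M < 0 := by
    refine ⟨(T / F) ^ (γ - p)⁻¹, ?_, ?_⟩
    · apply Real.rpow_lt_rpow hc0.le _ (inv_pos.2 hd)
      rw [div_lt_div_iff₀ (by positivity) hF]
      have : 0 < T * F := by positivity
      nlinarith
    · have hMp : 0 < (T / F) ^ (γ - p)⁻¹ := Real.rpow_pos_of_pos hTF _
      have hMe : ((T / F) ^ (γ - p)⁻¹) ^ (γ - p) = T / F := Real.rpow_inv_rpow hTF.le hd'
      simp only [hg]
      rw [hsplit _ hMp, hMe, mul_assoc _ (T / F) F, div_mul_cancel₀ _ hF.ne']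
      linarith
  obtain ⟨sp, ⟨hsp0, hsps⟩, hsp⟩ := intermediate_value_Ioo hs0p.le hgc.continuousOn
    (show (0 : ℝ) ∈ Set.Ioo (g 0) (g s0) from ⟨hg0, hgs0⟩)
  obtain ⟨sm, ⟨hsms, hsmM⟩, hsm⟩ := intermediate_value_Ioo' hM.le hgc.continuousOn
    (show (0 : ℝ) ∈ Set.Ioo (g M) (g s0) from ⟨hgM, hgs0⟩)
  have hsm0 : 0 < sm := hs0p.trans hsms
  have hp2 : 0 < deriv (deriv Φ) sp := by
    rw [hΦ2 sp hsp0 hsp]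
    exact mul_pos (Real.rpow_pos_of_pos hsp0 _)
      (mul_pos (Real.rpow_pos_of_pos hsp0 _) (hlt sp hsp0 hsps))
  have hm2 : deriv (deriv Φ) sm < 0 := by
    rw [hΦ2 sm hsm0 hsm]
    exact mul_neg_of_pos_of_neg (Real.rpow_pos_of_pos hsm0 _)
      (mul_neg_of_pos_of_neg (Real.rpow_pos_of_pos hsm0 _) (hgt sm hsms))
  refine ⟨sp, sm, hsp0, hsps.trans hsms, (hΦ0 sp hsp0).2 hsp, (hΦ0 sm hsm0).2 hsm, ?_, hp2, hm2,
    isLocalMin_of_deriv_deriv_pos hp2 ((hΦ0 sp hsp0).2 hsp) (hΦd sp hsp0).continuousAt,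
    isLocalMax_of_deriv_deriv_neg hm2 ((hΦ0 sm hsm0).2 hsm) (hΦd sm hsm0).continuousAt⟩
  intro s hs hs'
  have h0 := (hΦ0 s hs).1 hs'
  rcases le_total s s0 with h | h
  · left
    exact hmono.injOn ⟨hs.le, h⟩ ⟨hsp0.le, hsps.le⟩ (h0.trans hsp.symm)
  · right
    exact hanti.injOn (Set.mem_Ici.2 h) (Set.mem_Ici.2 hsms.le) (h0.trans hsm.symm)
end

section
/- Let 1 < q < p < γ be real numbers and T, Q, F > 0. Define R(s) = (s^p·T − s^γ·F)/(s^q·Q) and R^e(s) = ((s^p/p)·T − (s^γ/γ)·F)/((s^q/q)·Q) for s > 0. Then sup_{s>0} R^e(s) = c_{pq} · sup_{s>0} R(s), where c_{pq} = q·γ^{(p−q)/(γ−p)}/p^{(γ−q)/(γ−p)}, and c_{pq} < 1 (equivalently q^{γ−p}·γ^{p−q} < p^{γ−q}); consequently sup_{s>0} R^e(s) < sup_{s>0} R(s). -/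
/-- Section 3: `λ^e(u) = c_{pq}·λ(u)` with `c_{pq} = q·γ^{(p−q)/(γ−p)}/p^{(γ−q)/(γ−p)} < 1`
(equivalently `q^{γ−p}·γ^{p−q} < p^{γ−q}`), hence `sup R^e < sup R` along each fiber. -/
theorem stmt_7 (q p γ T Q F : ℝ)
    (hq : 1 < q) (hqp : q < p) (hpγ : p < γ)
    (hT : 0 < T) (hQ : 0 < Q) (hF : 0 < F)
    (R Re : ℝ → ℝ)
    (hR : R = fun s : ℝ => (s ^ p * T - s ^ γ * F) / (s ^ q * Q))
    (hRe : Re = fun s : ℝ => (s ^ p / p * T - s ^ γ / γ * F) / (s ^ q / q * Q))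
    (cpq : ℝ)
    (hcpq : cpq = q * γ ^ ((p - q) / (γ - p)) / p ^ ((γ - q) / (γ - p))) :
    (⨆ s : Set.Ioi (0 : ℝ), Re (s : ℝ)) = cpq * (⨆ s : Set.Ioi (0 : ℝ), R (s : ℝ)) ∧
    cpq < 1 ∧
    q ^ (γ - p) * γ ^ (p - q) < p ^ (γ - q) ∧
    (⨆ s : Set.Ioi (0 : ℝ), Re (s : ℝ)) < (⨆ s : Set.Ioi (0 : ℝ), R (s : ℝ)) := by
  have q0 : 0 < q := by linarith
  have p0 : 0 < p := by linarith
  have g0 : 0 < γ := by linarith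
  have d0 : 0 < γ - p := by linarith
  have e0 : 0 < p - q := by linarith
  have hlog : (γ - p) * Real.log q + (p - q) * Real.log γ < (γ - q) * Real.log p := by
    have h1 : Real.log (q / p) < q / p - 1 :=
      Real.log_lt_sub_one_of_pos (by positivity) (by rw [Ne, div_eq_one_iff_eq p0.ne']; linarith)
    have h2 : Real.log (γ / p) < γ / p - 1 :=
      Real.log_lt_sub_one_of_pos (by positivity) (by rw [Ne, div_eq_one_iff_eq p0.ne']; linarith)
    rw [Real.log_div q0.ne' p0.ne'] at h1
    rw [Real.log_div g0.ne' p0.ne'] at h2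
    have h3 := mul_lt_mul_of_pos_left h1 d0
    have h4 := mul_lt_mul_of_pos_left h2 e0
    have h5 : (γ - p) * (q / p - 1) + (p - q) * (γ / p - 1) = 0 := by
      field_simp
      ring
    nlinarith
  have hthird : q ^ (γ - p) * γ ^ (p - q) < p ^ (γ - q) := by
    rw [← Real.log_lt_log_iff (by positivity) (by positivity),
      Real.log_mul (by positivity) (by positivity), Real.log_rpow q0, Real.log_rpow g0,
      Real.log_rpow p0]
    exact hlog
  have hc0 : 0 < cpq := by rw [hcpq]; positivity
  have hc1 : cpq < 1 := by
    rw [hcpq, div_lt_one (by positivity),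
      ← Real.log_lt_log_iff (by positivity) (by positivity),
      Real.log_mul (by positivity) (by positivity), Real.log_rpow g0,
      Real.log_rpow p0]
    have : Real.log q + (p - q) / (γ - p) * Real.log γ
        = ((γ - p) * Real.log q + (p - q) * Real.log γ) / (γ - p) := by
      field_simp
    rw [this, div_mul_eq_mul_div]
    exact div_lt_div_of_pos_right hlog d0
  -- scaling
  obtain ⟨k, hk⟩ : ∃ k : ℝ, k = (γ / p) ^ (1 / (γ - p)) := ⟨_, rfl⟩
  have k0 : 0 < k := by rw [hk]; positivity
  have hkd : k ^ (γ - p) = γ / p := by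
    rw [hk, ← Real.rpow_mul (by positivity), one_div_mul_cancel d0.ne', Real.rpow_one]
  have hke : k ^ (p - q) = γ ^ ((p - q) / (γ - p)) / p ^ ((p - q) / (γ - p)) := by
    rw [hk, ← Real.rpow_mul (by positivity), Real.div_rpow g0.le p0.le]
    congr 2 <;> ring
  have hc : cpq = q / p * k ^ (p - q) := by
    have : (γ - q) / (γ - p) = 1 + (p - q) / (γ - p) := by
      field_simp
      ring
    rw [hcpq, hke, this, Real.rpow_add p0, Real.rpow_one]
    field_simp
  have split : ∀ s : ℝ, 0 < s → s ^ p = s ^ q * s ^ (p - q) ∧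
      s ^ γ = s ^ q * s ^ (p - q) * s ^ (γ - p) := by
    intro s hs
    constructor
    · rw [← Real.rpow_add hs]; congr 1; ring
    · rw [← Real.rpow_add hs, ← Real.rpow_add hs]; congr 1; ring
  have hscale : ∀ s : ℝ, 0 < s → Re (k * s) = cpq * R s := by
    intro s hs
    have hks : 0 < k * s := by positivity
    simp only [hR, hRe]
    rw [(split _ hks).1, (split _ hks).2, (split _ hs).1, (split _ hs).2, hc,
      Real.mul_rpow k0.le hs.le, Real.mul_rpow k0.le hs.le, Real.mul_rpow k0.le hs.le, hkd]
    have a1 : 0 < k ^ q := by positivity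
    have a2 : 0 < s ^ q := by positivity
    field_simp
  have hform : ∀ s : ℝ, 0 < s → R s = s ^ (p - q) * (T - s ^ (γ - p) * F) / Q := by
    intro s hs
    simp only [hR]
    rw [(split _ hs).1, (split _ hs).2]
    have a2 : 0 < s ^ q := by positivity
    field_simp
  have hsup : (⨆ s : Set.Ioi (0 : ℝ), Re (s : ℝ)) = cpq * (⨆ s : Set.Ioi (0 : ℝ), R (s : ℝ)) := by
    rw [Real.mul_iSup_of_nonneg hc0.le]
    have hsurj : Function.Surjective
        (fun s : Set.Ioi (0 : ℝ) => (⟨k * s, mul_pos k0 s.2⟩ : Set.Ioi (0 : ℝ))) := by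
      rintro ⟨t, ht⟩
      refine ⟨⟨t / k, div_pos ht k0⟩, ?_⟩
      apply Subtype.ext
      simp only
      field_simp
    rw [← hsurj.iSup_comp]
    exact iSup_congr fun s => hscale s s.2
  have hbdd : BddAbove (Set.range fun s : Set.Ioi (0 : ℝ) => R (s : ℝ)) := by
    refine ⟨((T / F) ^ (1 / (γ - p))) ^ (p - q) * T / Q, ?_⟩
    rintro _ ⟨⟨s, hs⟩, rfl⟩
    have hs : 0 < s := hs
    simp only
    rw [hform s hs]
    have b1 : 0 < s ^ (p - q) := by positivity
    have b2 : 0 < s ^ (γ - p) := by positivity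
    rcases le_total T (s ^ (γ - p) * F) with h | h
    · have : s ^ (p - q) * (T - s ^ (γ - p) * F) / Q ≤ 0 :=
        div_nonpos_of_nonpos_of_nonneg (mul_nonpos_of_nonneg_of_nonpos b1.le (by linarith)) hQ.le
      refine this.trans (by positivity)
    · have hle : s ≤ (T / F) ^ (1 / (γ - p)) := by
        have h' : s ^ (γ - p) ≤ T / F := by rwa [le_div_iff₀ hF]
        have := Real.rpow_le_rpow b2.le h' (by positivity : 0 ≤ 1 / (γ - p))
        rwa [← Real.rpow_mul hs.le, mul_one_div_cancel d0.ne', Real.rpow_one] at this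
      have h2 := Real.rpow_le_rpow hs.le hle e0.le
      have h3 : T - s ^ (γ - p) * F ≤ T := by nlinarith
      refine div_le_div_of_nonneg_right ?_ hQ.le
      exact mul_le_mul h2 h3 (by linarith) (by positivity)
  have hpos : 0 < ⨆ s : Set.Ioi (0 : ℝ), R (s : ℝ) := by
    have ht : 0 < (T / (2 * F)) ^ (1 / (γ - p)) := by positivity
    refine lt_of_lt_of_le ?_ (le_ciSup hbdd ⟨_, ht⟩)
    simp only
    rw [hform _ ht, ← Real.rpow_mul (by positivity) (1 / (γ - p)) (γ - p),
      one_div_mul_cancel d0.ne', Real.rpow_one]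
    have : T - T / (2 * F) * F = T / 2 := by
      field_simp
      ring
    rw [this]
    positivity
  refine ⟨hsup, hc1, hthird, ?_⟩
  rw [hsup]
  nlinarith
end

section
/- Let 1 < q < α < p < γ be real numbers and T, Q, F > 0. Then the function Λⁿ(t) = ((p−α)·t^p·T − (γ−α)·t^γ·F)/((α−q)·t^q·Q), t > 0, has exactly one critical point on (0,∞), namely tⁿ = (C_n·T/F)^{1/(γ−p)} with C_n = (p−α)(p−q)/((γ−α)(γ−q)); Λⁿ attains its global maximum over (0,∞) at tⁿ, and the maximum value is λⁿ := Λⁿ(tⁿ) = cⁿ_{q,γ}·T^{(γ−q)/(γ−p)}/(Q·F^{(p−q)/(γ−p)}), where cⁿ_{q,γ} = (γ−p)·(p−q)^{(p−q)/(γ−p)}·(p−α)^{(γ−q)/(γ−p)}/((α−q)·(γ−α)^{(p−q)/(γ−p)}·(γ−q)^{(γ−q)/(γ−p)}). -/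
theorem aux_max (a b A B t0 t : ℝ) (ha : 0 < a) (hab : a < b) (hA : 0 < A) (hB : 0 < B)
    (h0 : 0 < t0) (ht : 0 < t) (hc : a * A * t0 ^ a = b * B * t0 ^ b) :
    A * t ^ a - B * t ^ b ≤ A * t0 ^ a - B * t0 ^ b := by
  obtain ⟨r, hr, rfl⟩ : ∃ r : ℝ, 0 < r ∧ t = r * t0 := ⟨t / t0, by positivity, by field_simp⟩
  rw [Real.mul_rpow hr.le h0.le, Real.mul_rpow hr.le h0.le]
  have hra : 0 < r ^ a := by positivity
  have hber := one_add_mul_self_le_rpow_one_add (s := r ^ a - 1) (by linarith)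
    (p := b / a) (by rw [le_div_iff₀ ha]; linarith)
  rw [add_sub_cancel, ← Real.rpow_mul hr.le, mul_div_cancel₀ b ha.ne'] at hber
  have h1 : a + b * (r ^ a - 1) ≤ a * r ^ b := by
    have := mul_le_mul_of_nonneg_left hber ha.le
    have e : a * (1 + b / a * (r ^ a - 1)) = a + b * (r ^ a - 1) := by field_simp
    linarith
  have hBt : 0 < B * t0 ^ b := by positivity
  have h2 := mul_le_mul_of_nonneg_right h1 hBt.le
  have h3 : a * (A * (r ^ a * t0 ^ a) - B * (r ^ b * t0 ^ b)) ≤ a * (A * t0 ^ a - B * t0 ^ b) := by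
    have e1 : a * (A * (r ^ a * t0 ^ a)) = r ^ a * (b * B * t0 ^ b) := by rw [← hc]; ring
    have e2 : a * (A * t0 ^ a) = b * B * t0 ^ b := by rw [← hc]; ring
    rw [mul_sub, mul_sub, e1, e2]
    linarith
  exact le_of_mul_le_mul_left h3 ha

/-- Section 4: the fibered Rayleigh λ-quotient
`Λⁿ(t) = ((p−α)t^p·T − (γ−α)t^γ·F)/((α−q)t^q·Q)` has exactly one critical point
`tⁿ = (C_n·T/F)^{1/(γ−p)}` on `(0,∞)`, where it attains its global maximum, with explicit
maximum value `λⁿ = cⁿ_{q,γ}·T^{(γ−q)/(γ−p)}/(Q·F^{(p−q)/(γ−p)})`. -/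
theorem stmt_8 (q α p γ T Q F : ℝ)
    (hq : 1 < q) (hqα : q < α) (hαp : α < p) (hpγ : p < γ)
    (hT : 0 < T) (hQ : 0 < Q) (hF : 0 < F)
    (Λn : ℝ → ℝ)
    (hΛn : Λn = fun t : ℝ =>
      ((p - α) * t ^ p * T - (γ - α) * t ^ γ * F) / ((α - q) * t ^ q * Q))
    (Cn tn cn lamn : ℝ)
    (hCn : Cn = (p - α) * (p - q) / ((γ - α) * (γ - q)))
    (htn : tn = (Cn * T / F) ^ (1 / (γ - p)))
    (hcn : cn = (γ - p) * (p - q) ^ ((p - q) / (γ - p)) * (p - α) ^ ((γ - q) / (γ - p)) /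
      ((α - q) * (γ - α) ^ ((p - q) / (γ - p)) * (γ - q) ^ ((γ - q) / (γ - p))))
    (hlamn : lamn = cn * T ^ ((γ - q) / (γ - p)) / (Q * F ^ ((p - q) / (γ - p)))) :
    0 < tn ∧ deriv Λn tn = 0 ∧
    (∀ t : ℝ, 0 < t → deriv Λn t = 0 → t = tn) ∧
    (∀ t : ℝ, 0 < t → Λn t ≤ Λn tn) ∧
    Λn tn = lamn := by
  have h1 : 0 < α - q := by linarith
  have h2 : 0 < p - α := by linarith
  have h3 : 0 < γ - p := by linarith
  have h4 : 0 < γ - α := by linarith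
  have h5 : 0 < p - q := by linarith
  have h6 : 0 < γ - q := by linarith
  have hC : 0 < Cn := by rw [hCn]; positivity
  have hX : 0 < Cn * T / F := by positivity
  have h0 : 0 < tn := by rw [htn]; positivity
  obtain ⟨A, hA⟩ : ∃ A, A = (p - α) * T / ((α - q) * Q) := ⟨_, rfl⟩
  obtain ⟨B, hB⟩ : ∃ B, B = (γ - α) * F / ((α - q) * Q) := ⟨_, rfl⟩
  have hA0 : 0 < A := by rw [hA]; positivity
  have hB0 : 0 < B := by rw [hB]; positivity
  have hL : ∀ t : ℝ, 0 < t → Λn t = A * t ^ (p - q) - B * t ^ (γ - q) := by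
    intro t ht
    have htq : 0 < t ^ q := by positivity
    rw [hΛn, hA, hB, Real.rpow_sub ht, Real.rpow_sub ht]
    field_simp
  have htp : tn ^ (γ - p) = Cn * T / F := by
    rw [htn, ← Real.rpow_mul hX.le, one_div_mul_cancel h3.ne', Real.rpow_one]
  have hsplit : ∀ t : ℝ, 0 < t → t ^ (γ - q) = t ^ (p - q) * t ^ (γ - p) := by
    intro t ht
    rw [← Real.rpow_add ht]; congr 1; ring
  have hAB : (p - q) * A = (γ - q) * B * tn ^ (γ - p) := by
    rw [htp, hA, hB, hCn]; field_simp
  have hc : (p - q) * A * tn ^ (p - q) = (γ - q) * B * tn ^ (γ - q) := by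
    rw [hsplit tn h0, hAB]; ring
  have hD : ∀ t : ℝ, 0 < t → deriv Λn t =
      t ^ (p - q) / t * ((γ - q) * B) * (tn ^ (γ - p) - t ^ (γ - p)) := by
    intro t ht
    have hd : HasDerivAt (fun t : ℝ => A * t ^ (p - q) - B * t ^ (γ - q))
        (A * ((p - q) * t ^ (p - q - 1)) - B * ((γ - q) * t ^ (γ - q - 1))) t :=
      ((Real.hasDerivAt_rpow_const (Or.inl ht.ne')).const_mul A).sub
        ((Real.hasDerivAt_rpow_const (Or.inl ht.ne')).const_mul B)
    have he : Λn =ᶠ[nhds t] (fun t : ℝ => A * t ^ (p - q) - B * t ^ (γ - q)) := by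
      filter_upwards [lt_mem_nhds ht] with s hs using hL s hs
    rw [he.deriv_eq, hd.deriv, Real.rpow_sub_one ht.ne', Real.rpow_sub_one ht.ne', hsplit t ht]
    linear_combination (t ^ (p - q) / t) * hAB
  refine ⟨h0, ?_, ?_, ?_, ?_⟩
  · rw [hD tn h0, sub_self, mul_zero]
  · intro t ht hdt
    rw [hD t ht] at hdt
    have hpos : t ^ (p - q) / t * ((γ - q) * B) ≠ 0 := by positivity
    have he := (mul_eq_zero.mp hdt).resolve_left hpos
    exact (Real.rpow_left_inj ht.le h0.le h3.ne').mp (by linarith)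
  · intro t ht
    rw [hL t ht, hL tn h0]
    exact aux_max _ _ A B tn t h5 (by linarith) hA0 hB0 h0 ht hc
  · have hs : (γ - q) / (γ - p) = (p - q) / (γ - p) + 1 := by field_simp; ring
    have ht : tn ^ (p - q) = (Cn * T / F) ^ ((p - q) / (γ - p)) := by
      rw [htn, ← Real.rpow_mul hX.le]; congr 1; ring
    rw [hL tn h0, hsplit tn h0, htp, ht, hlamn, hcn, hs]
    generalize (p - q) / (γ - p) = s
    rw [Real.rpow_add_one h2.ne', Real.rpow_add_one h6.ne', Real.rpow_add_one hT.ne',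
      Real.div_rpow (by positivity) hF.le, Real.mul_rpow hC.le hT.le, hA, hB, hCn,
      Real.div_rpow (by positivity) (by positivity), Real.mul_rpow h2.le h5.le,
      Real.mul_rpow h4.le h6.le]
    have p1 : 0 < (p - α) ^ s := by positivity
    have p2 : 0 < (p - q) ^ s := by positivity
    have p3 : 0 < (γ - α) ^ s := by positivity
    have p4 : 0 < (γ - q) ^ s := by positivity
    have p5 : 0 < F ^ s := by positivity
    have p6 : 0 < T ^ s := by positivity
    generalize (p - α) ^ s = x1 at *
    generalize (p - q) ^ s = x2 at *
    generalize (γ - α) ^ s = x3 at *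
    generalize (γ - q) ^ s = x4 at *
    field_simp
    ring
end

section
/- Let 1 < q < α < p < γ be real numbers and T, Q, F, A > 0. Set λⁿ = sup_{t>0} Λⁿ(t), where Λⁿ(t) = ((p−α)·t^p·T − (γ−α)·t^γ·F)/((α−q)·t^q·Q). Then for every λ with 0 < λ < λⁿ, the function Rⁿ_λ(t) = (t^p·T + λ·t^q·Q − t^γ·F)/(t^α·A) has precisely two critical points on (0,∞), say 0 < t^{n,+} < t^{n,−}, and (Rⁿ_λ)''(t^{n,+}) > 0 while (Rⁿ_λ)''(t^{n,−}) < 0; i.e. t^{n,+} is a nondegenerate local minimum point and t^{n,−} a nondegenerate local maximum point of Rⁿ_λ. -/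
lemma aux_g (a b c r s t1 : ℝ) (ha : 0 < a) (hb : 0 < b) (hc : 0 < c) (hr : 0 < r) (hrs : r < s)
    (ht1 : 0 < t1) (h1 : 0 < a * t1 ^ r - b * t1 ^ s - c) :
    ∃ x y : ℝ, 0 < x ∧ x < y ∧ a * x ^ r - b * x ^ s - c = 0 ∧ a * y ^ r - b * y ^ s - c = 0 ∧
      (∀ t : ℝ, 0 < t → a * t ^ r - b * t ^ s - c = 0 → t = x ∨ t = y) ∧
      0 < a * (r * x ^ (r - 1)) - b * (s * x ^ (s - 1)) ∧
      a * (r * y ^ (r - 1)) - b * (s * y ^ (s - 1)) < 0 := by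
  have hs : 0 < s := hr.trans hrs
  have hd : 0 < s - r := sub_pos.2 hrs
  set g : ℝ → ℝ := fun t => a * t ^ r - b * t ^ s - c with hg
  have hcont : Continuous g :=
    (((Real.continuous_rpow_const hr.le).const_mul a).sub
      ((Real.continuous_rpow_const hs.le).const_mul b)).sub continuous_const
  have hder : ∀ t, 0 < t → HasDerivAt g (a * (r * t ^ (r - 1)) - b * (s * t ^ (s - 1))) t := by
    intro t ht
    exact (((Real.hasDerivAt_rpow_const (Or.inl ht.ne')).const_mul a).sub
      ((Real.hasDerivAt_rpow_const (Or.inl ht.ne')).const_mul b)).sub_const c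
  set t0 : ℝ := (a * r / (b * s)) ^ (s - r)⁻¹ with ht0
  have hm : 0 < a * r / (b * s) := by positivity
  have ht0p : 0 < t0 := Real.rpow_pos_of_pos hm _
  have ht0e : t0 ^ (s - r) = a * r / (b * s) := Real.rpow_inv_rpow hm.le hd.ne'
  have hfac : ∀ t, 0 < t → a * (r * t ^ (r - 1)) - b * (s * t ^ (s - 1))
      = t ^ (r - 1) * (a * r - b * s * t ^ (s - r)) := by
    intro t ht
    have : t ^ (s - 1) = t ^ (r - 1) * t ^ (s - r) := by
      rw [← Real.rpow_add ht]; congr 1; ring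
    rw [this]; ring
  have hpos : ∀ t, 0 < t → t < t0 → 0 < a * (r * t ^ (r - 1)) - b * (s * t ^ (s - 1)) := by
    intro t ht h
    rw [hfac t ht]
    have h2 : t ^ (s - r) < a * r / (b * s) := ht0e ▸ Real.rpow_lt_rpow ht.le h hd
    rw [lt_div_iff₀ (by positivity)] at h2
    exact mul_pos (Real.rpow_pos_of_pos ht _) (by linarith)
  have hneg : ∀ t, t0 < t → a * (r * t ^ (r - 1)) - b * (s * t ^ (s - 1)) < 0 := by
    intro t h
    have ht := ht0p.trans h
    rw [hfac t ht]
    have h2 : a * r / (b * s) < t ^ (s - r) := ht0e ▸ Real.rpow_lt_rpow ht0p.le h hd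
    rw [div_lt_iff₀ (by positivity)] at h2
    exact mul_neg_of_pos_of_neg (Real.rpow_pos_of_pos ht _) (by linarith)
  have hmono : StrictMonoOn g (Set.Icc 0 t0) := by
    apply strictMonoOn_of_deriv_pos (convex_Icc _ _) hcont.continuousOn
    intro t ht
    rw [interior_Icc] at ht
    rw [(hder t ht.1).deriv]
    exact hpos t ht.1 ht.2
  have hanti : StrictAntiOn g (Set.Ici t0) := by
    apply strictAntiOn_of_deriv_neg (convex_Ici _) hcont.continuousOn
    intro t ht
    rw [interior_Ici] at ht
    rw [(hder t (ht0p.trans ht)).deriv]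
    exact hneg t ht
  have hgt0 : 0 < g t0 := by
    refine lt_of_lt_of_le h1 ?_
    change g t1 ≤ g t0
    rcases le_total t1 t0 with h | h
    · exact hmono.monotoneOn ⟨ht1.le, h⟩ ⟨ht0p.le, le_rfl⟩ h
    · exact hanti.antitoneOn Set.self_mem_Ici h h
  have hg0 : g 0 < 0 := by
    simp only [hg, Real.zero_rpow hr.ne', Real.zero_rpow hs.ne']; linarith
  set t2 : ℝ := (a / b) ^ (s - r)⁻¹ with ht2
  have ht2p : 0 < t2 := Real.rpow_pos_of_pos (by positivity) _
  have ht2e : t2 ^ (s - r) = a / b := Real.rpow_inv_rpow (by positivity) hd.ne'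
  have hgt2 : g t2 < 0 := by
    have : t2 ^ s = t2 ^ r * t2 ^ (s - r) := by
      rw [← Real.rpow_add ht2p]; congr 1; ring
    have h3 : g t2 = -c := by
      simp only [hg]; rw [this, ht2e]; field_simp; ring
    linarith
  have h02 : t0 < t2 := by
    apply Real.rpow_lt_rpow hm.le _ (inv_pos.2 hd)
    rw [div_lt_div_iff₀ (by positivity) hb]
    have := mul_lt_mul_of_pos_left hrs (mul_pos ha hb)
    nlinarith
  obtain ⟨x, hx, hgx⟩ := intermediate_value_Ioo ht0p.le hcont.continuousOn ⟨hg0, hgt0⟩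
  obtain ⟨y, hy, hgy⟩ := intermediate_value_Ioo' h02.le hcont.continuousOn ⟨hgt2, hgt0⟩
  refine ⟨x, y, hx.1, hx.2.trans hy.1, hgx, hgy, ?_, hpos x hx.1 hx.2, hneg y hy.1⟩
  intro t ht h
  rcases le_total t t0 with h' | h'
  · exact Or.inl (hmono.injOn ⟨ht.le, h'⟩ ⟨hx.1.le, hx.2.le⟩ (h.trans hgx.symm))
  · exact Or.inr (hanti.injOn h' hy.1.le (h.trans hgy.symm))

/-- Fiberwise content of Proposition 4.1: for `0 < λ < λⁿ = sup_{t>0} Λⁿ(t)`, the fibered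
Rayleigh quotient `Rⁿ_λ` has precisely two critical points `0 < t^{n,+} < t^{n,−}` on
`(0,∞)`, a nondegenerate local minimum and a nondegenerate local maximum. -/
theorem stmt_10 (q α p γ T Q F A lam lamn : ℝ)
    (hq : 1 < q) (hqα : q < α) (hαp : α < p) (hpγ : p < γ)
    (hT : 0 < T) (hQ : 0 < Q) (hF : 0 < F) (hA : 0 < A)
    (Rn Λn : ℝ → ℝ)
    (hRn : Rn = fun t : ℝ => (t ^ p * T + lam * t ^ q * Q - t ^ γ * F) / (t ^ α * A))
    (hΛn : Λn = fun t : ℝ =>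
      ((p - α) * t ^ p * T - (γ - α) * t ^ γ * F) / ((α - q) * t ^ q * Q))
    (hlamn : lamn = ⨆ t : Set.Ioi (0 : ℝ), Λn (t : ℝ))
    (hlam0 : 0 < lam) (hlam : lam < lamn) :
    ∃ tnp tnm : ℝ, 0 < tnp ∧ tnp < tnm ∧
      deriv Rn tnp = 0 ∧ deriv Rn tnm = 0 ∧
      (∀ t : ℝ, 0 < t → deriv Rn t = 0 → t = tnp ∨ t = tnm) ∧
      0 < deriv (deriv Rn) tnp ∧ deriv (deriv Rn) tnm < 0 ∧
      IsLocalMin Rn tnp ∧ IsLocalMax Rn tnm := by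
  have hαq : 0 < α - q := sub_pos.2 hqα
  have hpα : 0 < p - α := sub_pos.2 hαp
  have hγα : 0 < γ - α := by linarith
  rw [hlamn] at hlam
  obtain ⟨⟨t1, ht1⟩, h1⟩ := exists_lt_of_lt_ciSup hlam
  have ht1 : 0 < t1 := ht1
  have hsplit : ∀ t : ℝ, 0 < t → ∀ u v : ℝ, t ^ u = t ^ v * t ^ (u - v) := by
    intro t ht u v
    rw [← Real.rpow_add ht]; congr 1; ring
  have h1' : 0 < (T * (p - α)) * t1 ^ (p - q) - (F * (γ - α)) * t1 ^ (γ - q)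
      - lam * Q * (α - q) := by
    have hqp := Real.rpow_pos_of_pos ht1 q
    simp only [hΛn] at h1
    rw [lt_div_iff₀ (by positivity), hsplit t1 ht1 p q, hsplit t1 ht1 γ q] at h1
    by_contra hcon
    have := mul_nonneg hqp.le (sub_nonneg.2 (not_lt.1 hcon))
    nlinarith
  obtain ⟨x, y, hx, hxy, hgx, hgy, huniq, hdx, hdy⟩ := aux_g (T * (p - α)) (F * (γ - α))
    (lam * Q * (α - q)) (p - q) (γ - q) t1 (by positivity) (by positivity) (by positivity)
    (by linarith) (by linarith) ht1 h1'
  set g : ℝ → ℝ := fun t => (T * (p - α)) * t ^ (p - q) - (F * (γ - α)) * t ^ (γ - q)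
      - lam * Q * (α - q) with hg
  have hy : 0 < y := hx.trans hxy
  have hR : ∀ t, 0 < t → HasDerivAt Rn (A⁻¹ * t ^ (q - α - 1) * g t) t := by
    intro t ht
    have e : Rn =ᶠ[nhds t] fun t => A⁻¹ * (t ^ (p - α) * T + t ^ (q - α) * (lam * Q)
        - t ^ (γ - α) * F) := by
      filter_upwards [lt_mem_nhds ht] with z hz
      have := Real.rpow_pos_of_pos hz α
      simp only [hRn]
      rw [hsplit z hz p α, hsplit z hz q α, hsplit z hz γ α]
      field_simp
    refine HasDerivAt.congr_of_eventuallyEq ?_ e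
    have hp' : ∀ u : ℝ, HasDerivAt (fun t : ℝ => t ^ u) (u * t ^ (u - 1)) t := fun u =>
      Real.hasDerivAt_rpow_const (Or.inl ht.ne')
    refine (((((hp' (p - α)).mul_const T).add ((hp' (q - α)).mul_const (lam * Q))).sub
      ((hp' (γ - α)).mul_const F)).const_mul A⁻¹).congr_deriv ?_
    rw [hsplit t ht (p - α - 1) (q - α - 1), hsplit t ht (γ - α - 1) (q - α - 1)]
    simp only [hg]
    rw [show p - α - 1 - (q - α - 1) = p - q by ring, show γ - α - 1 - (q - α - 1) = γ - q by ring]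
    ring
  have hRd : ∀ t, 0 < t → deriv Rn t = A⁻¹ * t ^ (q - α - 1) * g t := fun t ht => (hR t ht).deriv
  have hw : ∀ t : ℝ, 0 < t → 0 < A⁻¹ * t ^ (q - α - 1) := fun t ht =>
    mul_pos (inv_pos.2 hA) (Real.rpow_pos_of_pos ht _)
  have hR2 : ∀ t, 0 < t → g t = 0 → deriv (deriv Rn) t = A⁻¹ * t ^ (q - α - 1) *
      (T * (p - α) * ((p - q) * t ^ (p - q - 1)) - F * (γ - α) * ((γ - q) * t ^ (γ - q - 1))) := by
    intro t ht h0
    have e : deriv Rn =ᶠ[nhds t] fun t => A⁻¹ * t ^ (q - α - 1) * g t := by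
      filter_upwards [lt_mem_nhds ht] with z hz using hRd z hz
    have hp' : ∀ u : ℝ, HasDerivAt (fun t : ℝ => t ^ u) (u * t ^ (u - 1)) t := fun u =>
      Real.hasDerivAt_rpow_const (Or.inl ht.ne')
    have hgd : HasDerivAt g (T * (p - α) * ((p - q) * t ^ (p - q - 1))
        - F * (γ - α) * ((γ - q) * t ^ (γ - q - 1))) t :=
      (((hp' _).const_mul _).sub ((hp' _).const_mul _)).sub_const _
    rw [e.deriv_eq]
    refine (((hp' (q - α - 1)).const_mul A⁻¹).mul hgd).deriv.trans ?_
    rw [h0]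
    ring
  have hx1 : deriv Rn x = 0 := by rw [hRd x hx, show g x = 0 from hgx, mul_zero]
  have hy1 : deriv Rn y = 0 := by rw [hRd y hy, show g y = 0 from hgy, mul_zero]
  have hx2 : 0 < deriv (deriv Rn) x := by rw [hR2 x hx hgx]; exact mul_pos (hw x hx) hdx
  have hy2 : deriv (deriv Rn) y < 0 := by
    rw [hR2 y hy hgy]; exact mul_neg_of_pos_of_neg (hw y hy) hdy
  refine ⟨x, y, hx, hxy, hx1, hy1, ?_, hx2, hy2,
    isLocalMin_of_deriv_deriv_pos hx2 hx1 (hR x hx).continuousAt,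
    isLocalMax_of_deriv_deriv_neg hy2 hy1 (hR y hy).continuousAt⟩
  intro t ht h
  rw [hRd t ht] at h
  exact huniq t ht ((mul_eq_zero.1 h).resolve_left (hw t ht).ne')
end

section
/- Let 1 < q < α < p < γ be real numbers, T, Q, F, A > 0, and let 0 < λ < λⁿ := sup_{t>0} Λⁿ(t), where Λⁿ(t) = ((p−α)·t^p·T − (γ−α)·t^γ·F)/((α−q)·t^q·Q). Let t^{n,−} denote the largest critical point of Rⁿ_λ(t) = (t^p·T + λ·t^q·Q − t^γ·F)/(t^α·A) on (0,∞) (its local maximum point). If μ ∈ ℝ satisfies μ < Rⁿ_λ(t^{n,−}), then there exists s₂ > t^{n,−} such that Rⁿ_λ(s₂) = μ and (Rⁿ_λ)'(s₂) < 0; equivalently, the fibering energy function Φ(s) = (s^p/p)·T + λ·(s^q/q)·Q − μ·(s^α/α)·A − (s^γ/γ)·F satisfies Φ'(s₂) = 0 and Φ''(s₂) < 0. -/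
/-- Fiberwise content of Proposition 4.2: for `0 < λ < λⁿ` and `μ < Rⁿ_λ(t^{n,−})` (where
`t^{n,−}` is the largest critical point of `Rⁿ_λ` on `(0,∞)`), there exists `s₂ > t^{n,−}`
with `Rⁿ_λ(s₂) = μ` and `(Rⁿ_λ)'(s₂) < 0`; equivalently the fibering energy function `Φ`
satisfies `Φ'(s₂) = 0` and `Φ''(s₂) < 0`. -/
theorem stmt_11 (q α p γ T Q F A lam μ lamn : ℝ)
    (hq : 1 < q) (hqα : q < α) (hαp : α < p) (hpγ : p < γ)
    (hT : 0 < T) (hQ : 0 < Q) (hF : 0 < F) (hA : 0 < A)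
    (Rn Λn Φ : ℝ → ℝ)
    (hRn : Rn = fun t : ℝ => (t ^ p * T + lam * t ^ q * Q - t ^ γ * F) / (t ^ α * A))
    (hΛn : Λn = fun t : ℝ =>
      ((p - α) * t ^ p * T - (γ - α) * t ^ γ * F) / ((α - q) * t ^ q * Q))
    (hΦ : Φ = fun s : ℝ =>
      s ^ p / p * T + lam * (s ^ q / q) * Q - μ * (s ^ α / α) * A - s ^ γ / γ * F)
    (hlamn : lamn = ⨆ t : Set.Ioi (0 : ℝ), Λn (t : ℝ))
    (hlam0 : 0 < lam) (hlam : lam < lamn)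
    (tnm : ℝ) (htnm0 : 0 < tnm)
    (htnmcrit : deriv Rn tnm = 0)
    (htnmmax : ∀ t : ℝ, 0 < t → deriv Rn t = 0 → t ≤ tnm)
    (hμ : μ < Rn tnm) :
    ∃ s₂ : ℝ, tnm < s₂ ∧ Rn s₂ = μ ∧ deriv Rn s₂ < 0 ∧
      deriv Φ s₂ = 0 ∧ deriv (deriv Φ) s₂ < 0 := by
  have hdiff : ∀ t : ℝ, 0 < t → DifferentiableAt ℝ Rn t := by
    intro t ht
    have hp : ∀ r : ℝ, DifferentiableAt ℝ (fun x : ℝ => x ^ r) t := fun r =>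
      (Real.hasDerivAt_rpow_const (Or.inl ht.ne')).differentiableAt
    have hne : t ^ α * A ≠ 0 := (mul_pos (Real.rpow_pos_of_pos ht _) hA).ne'
    rw [hRn]
    exact ((((hp p).mul_const T).add (((hp q).const_mul lam).mul_const Q)).sub
      ((hp γ).mul_const F)).div ((hp α).mul_const A) hne
  obtain ⟨M, hM, hRM⟩ : ∃ M, tnm < M ∧ Rn M < μ := by
    have h1 := (tendsto_rpow_atTop (sub_pos.2 hpγ)).eventually_gt_atTop
      ((T + lam * Q + |μ| * A) / F)
    obtain ⟨M, h1, h2, h3⟩ := (h1.and ((Filter.eventually_gt_atTop tnm).and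
      (Filter.eventually_ge_atTop (1 : ℝ)))).exists
    refine ⟨M, h2, ?_⟩
    have hM0 : 0 < M := by linarith
    rw [div_lt_iff₀ hF] at h1
    have e : M ^ γ = M ^ p * M ^ (γ - p) := by
      rw [← Real.rpow_add hM0]; congr 1; ring
    have hq' : M ^ q ≤ M ^ p := Real.rpow_le_rpow_of_exponent_le h3 (by linarith)
    have hα' : M ^ α ≤ M ^ p := Real.rpow_le_rpow_of_exponent_le h3 hαp.le
    have hpp : 0 < M ^ p := Real.rpow_pos_of_pos hM0 _
    have hαα : 0 < M ^ α := Real.rpow_pos_of_pos hM0 _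
    rw [hRn]
    simp only
    rw [div_lt_iff₀ (mul_pos hαα hA), e]
    have a1 := mul_lt_mul_of_pos_left h1 hpp
    have a2 := mul_le_mul_of_nonneg_left hq' (mul_pos hlam0 hQ).le
    have a3 := mul_le_mul_of_nonneg_left hα' (mul_nonneg (abs_nonneg μ) hA.le)
    have a4 := mul_le_mul_of_nonneg_right (neg_abs_le μ) (mul_pos hαα hA).le
    nlinarith
  have hcont : ContinuousOn Rn (Set.Ici tnm) := fun x hx =>
    (hdiff x (lt_of_lt_of_le htnm0 hx)).continuousAt.continuousWithinAt
  have hneg : ∀ x ∈ Set.Ioi tnm, deriv Rn x < 0 := by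
    rcases hasDerivWithinAt_forall_lt_or_forall_gt_of_forall_ne (m := 0) (convex_Ioi tnm)
      (f := Rn) (fun x hx => (hdiff x (htnm0.trans hx)).hasDerivAt.hasDerivWithinAt)
      (fun x hx h0 => absurd (htnmmax x (htnm0.trans hx) h0) (not_le.2 hx)) with h | h
    · exact h
    · exfalso
      have := strictMonoOn_of_deriv_pos (convex_Ici tnm) hcont (by rwa [interior_Ici])
      have := this (Set.self_mem_Ici) (Set.mem_Ici.2 hM.le) hM
      linarith
  obtain ⟨s, hs, hRs⟩ := intermediate_value_Ioo' hM.le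
    (hcont.mono Set.Icc_subset_Ici_self) ⟨hRM, hμ⟩
  have hs0 : 0 < s := htnm0.trans hs.1
  have hΦ' : ∀ t : ℝ, 0 < t → deriv Φ t = t ^ (α - 1) * A * (Rn t - μ) := by
    intro t ht
    have hp : ∀ r : ℝ, 0 < r → HasDerivAt (fun x : ℝ => x ^ r / r) (t ^ (r - 1)) t := by
      intro r hr
      have := (Real.hasDerivAt_rpow_const (x := t) (p := r) (Or.inl ht.ne')).div_const r
      rwa [mul_div_cancel_left₀ _ hr.ne'] at this
    have h : HasDerivAt Φ (t ^ (p - 1) * T + lam * t ^ (q - 1) * Q - μ * t ^ (α - 1) * A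
        - t ^ (γ - 1) * F) t := by
      rw [hΦ]
      exact ((((hp p (by linarith)).mul_const T).add
        (((hp q (by linarith)).const_mul lam).mul_const Q)).sub
        (((hp α (by linarith)).const_mul μ).mul_const A)).sub
        ((hp γ (by linarith)).mul_const F)
    rw [h.deriv, hRn]
    have hαα : t ^ α ≠ 0 := (Real.rpow_pos_of_pos ht _).ne'
    simp only [Real.rpow_sub_one ht.ne']
    field_simp
    ring
  refine ⟨s, hs.1, hRs, hneg s hs.1, by rw [hΦ' s hs0, hRs]; ring, ?_⟩
  have hev : deriv Φ =ᶠ[nhds s] fun t => t ^ (α - 1) * A * (Rn t - μ) := by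
    filter_upwards [Ioi_mem_nhds hs0] with t ht using hΦ' t ht
  have hd := ((Real.hasDerivAt_rpow_const (x := s) (p := α - 1) (Or.inl hs0.ne')).mul_const A).mul
    ((hdiff s hs0).hasDerivAt.sub_const μ)
  have hd2 := (hd.congr_of_eventuallyEq hev).deriv
  rw [hd2, hRs, sub_self, mul_zero, zero_add]
  exact mul_neg_of_pos_of_neg (mul_pos (Real.rpow_pos_of_pos hs0 _) hA) (hneg s hs.1)
end

section
/- Let 1 < q < α < p < γ be real numbers and T, Q, F, A > 0. Set λ^e = sup_{t>0} Λ^e(t), where Λ^e(t) = q·((p−α)·t^p·T/p − (γ−α)·t^γ·F/γ)/((α−q)·t^q·Q). Then for every λ with 0 < λ < λ^e, the function R^e_λ(t) = ((t^p/p)·T + λ·(t^q/q)·Q − (t^γ/γ)·F)/((t^α/α)·A) has precisely two critical points on (0,∞), say 0 < t^{e,+} < t^{e,−}, and (R^e_λ)''(t^{e,+}) > 0 while (R^e_λ)''(t^{e,−}) < 0. -/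
lemma aux_deriv (a b m n l t : ℝ) (ht : 0 < t) :
    HasDerivAt (fun t : ℝ => a * t ^ m - b * t ^ n - l)
      (t ^ (m - 1) * (a * m - b * n * t ^ (n - m))) t := by
  have h1 := (Real.hasDerivAt_rpow_const (x := t) (p := m) (Or.inl ht.ne')).const_mul a
  have h2 := (Real.hasDerivAt_rpow_const (x := t) (p := n) (Or.inl ht.ne')).const_mul b
  refine HasDerivAt.congr_deriv (f := fun t : ℝ => a * t ^ m - b * t ^ n - l) ((h1.sub h2).sub_const l) ?_
  have : t ^ (n - 1) = t ^ (m - 1) * t ^ (n - m) := by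
    rw [← Real.rpow_add ht]; congr 1; ring
  rw [this]; ring

lemma aux_main (a b m n l s : ℝ) (ha : 0 < a) (hb : 0 < b) (hm : 0 < m) (hmn : m < n)
    (hl : 0 < l) (hs : 0 < s) (hgs : 0 < a * s ^ m - b * s ^ n - l) :
    ∃ x y : ℝ, 0 < x ∧ x < y ∧ a * x ^ m - b * x ^ n - l = 0 ∧ a * y ^ m - b * y ^ n - l = 0 ∧
      (∀ t : ℝ, 0 < t → a * t ^ m - b * t ^ n - l = 0 → t = x ∨ t = y) ∧
      0 < x ^ (m - 1) * (a * m - b * n * x ^ (n - m)) ∧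
      y ^ (m - 1) * (a * m - b * n * y ^ (n - m)) < 0 := by
  have hn : 0 < n := hm.trans hmn
  have hd : 0 < n - m := sub_pos.2 hmn
  set g : ℝ → ℝ := fun t => a * t ^ m - b * t ^ n - l with hg
  obtain ⟨t0, ht0, ht0e⟩ : ∃ t0 : ℝ, 0 < t0 ∧ t0 ^ (n - m) = a * m / (b * n) :=
    ⟨(a * m / (b * n)) ^ (n - m)⁻¹, by positivity, Real.rpow_inv_rpow (by positivity) hd.ne'⟩
  obtain ⟨M, hM, hMe⟩ : ∃ M : ℝ, 0 < M ∧ M ^ (n - m) = a / b :=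
    ⟨(a / b) ^ (n - m)⁻¹, by positivity, Real.rpow_inv_rpow (by positivity) hd.ne'⟩
  have hbt : b * n * t0 ^ (n - m) = a * m := by rw [ht0e]; field_simp
  have htM : t0 < M := by
    rw [← Real.rpow_lt_rpow_iff ht0.le hM.le hd, ht0e, hMe, div_lt_div_iff₀ (by positivity) hb]
    nlinarith [mul_pos ha hb]
  have hpos : ∀ t : ℝ, 0 < t → t < t0 → 0 < t ^ (m - 1) * (a * m - b * n * t ^ (n - m)) := by
    intro t h h'
    have := Real.rpow_lt_rpow h.le h' hd
    have h3 : b * n * t ^ (n - m) < b * n * t0 ^ (n - m) := by gcongr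
    exact mul_pos (by positivity) (by linarith)
  have hneg : ∀ t : ℝ, t0 < t → t ^ (m - 1) * (a * m - b * n * t ^ (n - m)) < 0 := by
    intro t h'
    have h := ht0.trans h'
    have := Real.rpow_lt_rpow ht0.le h' hd
    have h3 : b * n * t0 ^ (n - m) < b * n * t ^ (n - m) := by gcongr
    exact mul_neg_of_pos_of_neg (by positivity) (by linarith)
  have hc : Continuous g := by
    have h1 := Real.continuous_rpow_const hm.le
    have h2 := Real.continuous_rpow_const hn.le
    exact ((continuous_const.mul h1).sub (continuous_const.mul h2)).sub continuous_const
  have hmono : StrictMonoOn g (Set.Icc 0 t0) := by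
    apply strictMonoOn_of_deriv_pos (convex_Icc _ _) hc.continuousOn
    intro t ht
    rw [interior_Icc] at ht
    rw [(aux_deriv a b m n l t ht.1).deriv]
    exact hpos t ht.1 ht.2
  have hanti : StrictAntiOn g (Set.Ici t0) := by
    apply strictAntiOn_of_deriv_neg (convex_Ici _) hc.continuousOn
    intro t ht
    rw [interior_Ici] at ht
    rw [(aux_deriv a b m n l t (ht0.trans ht)).deriv]
    exact hneg t ht
  have hg0 : g 0 < 0 := by
    simp [hg, Real.zero_rpow hm.ne', Real.zero_rpow hn.ne', hl]
  have hgM : g M < 0 := by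
    have : M ^ n = M ^ m * M ^ (n - m) := by
      rw [← Real.rpow_add hM]; congr 1; ring
    have h2 : g M = -l := by
      simp only [hg]
      rw [this, hMe]; field_simp; ring
    rw [h2]; linarith
  have hgt0 : 0 < g t0 := by
    refine lt_of_lt_of_le (show 0 < g s from hgs) ?_
    rcases le_total s t0 with h | h
    · exact hmono.monotoneOn ⟨hs.le, h⟩ ⟨ht0.le, le_rfl⟩ h
    · exact hanti.antitoneOn Set.self_mem_Ici h h
  obtain ⟨x, hx, hgx⟩ := intermediate_value_Ioo ht0.le hc.continuousOn ⟨hg0, hgt0⟩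
  obtain ⟨y, hy, hgy⟩ := intermediate_value_Ioo' htM.le hc.continuousOn ⟨hgM, hgt0⟩
  refine ⟨x, y, hx.1, hx.2.trans hy.1, hgx, hgy, ?_, hpos x hx.1 hx.2, hneg y hy.1⟩
  intro t ht hgt
  rcases le_total t t0 with h | h
  · exact Or.inl (hmono.injOn ⟨ht.le, h⟩ ⟨hx.1.le, hx.2.le⟩ ((show g t = 0 from hgt).trans hgx.symm))
  · exact Or.inr (hanti.injOn h hy.1.le ((show g t = 0 from hgt).trans hgy.symm))

/-- Fiberwise content of Proposition 4.3: for `0 < λ < λ^e = sup_{t>0} Λ^e(t)`, the fibered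
zero-energy Rayleigh quotient `R^e_λ` has precisely two critical points
`0 < t^{e,+} < t^{e,−}` on `(0,∞)`, with `(R^e_λ)''(t^{e,+}) > 0` and
`(R^e_λ)''(t^{e,−}) < 0`. -/
theorem stmt_12 (q α p γ T Q F A lam lame : ℝ)
    (hq : 1 < q) (hqα : q < α) (hαp : α < p) (hpγ : p < γ)
    (hT : 0 < T) (hQ : 0 < Q) (hF : 0 < F) (hA : 0 < A)
    (Re Λe : ℝ → ℝ)
    (hRe : Re = fun t : ℝ =>
      (t ^ p / p * T + lam * (t ^ q / q) * Q - t ^ γ / γ * F) / (t ^ α / α * A))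
    (hΛe : Λe = fun t : ℝ =>
      q * ((p - α) * t ^ p * T / p - (γ - α) * t ^ γ * F / γ) / ((α - q) * t ^ q * Q))
    (hlame : lame = ⨆ t : Set.Ioi (0 : ℝ), Λe (t : ℝ))
    (hlam0 : 0 < lam) (hlam : lam < lame) :
    ∃ tep tem : ℝ, 0 < tep ∧ tep < tem ∧
      deriv Re tep = 0 ∧ deriv Re tem = 0 ∧
      (∀ t : ℝ, 0 < t → deriv Re t = 0 → t = tep ∨ t = tem) ∧
      0 < deriv (deriv Re) tep ∧ deriv (deriv Re) tem < 0 := by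
  have hp0 : 0 < p := by linarith
  have hα0 : 0 < α := by linarith
  have hq0 : 0 < q := by linarith
  have hγ0 : 0 < γ := by linarith
  have h1 : 0 < α - q := by linarith
  have h2 : 0 < p - α := by linarith
  have h3 : 0 < γ - α := by linarith
  set a : ℝ := q * (p - α) * T / (p * (α - q) * Q) with ha
  set b : ℝ := q * (γ - α) * F / (γ * (α - q) * Q) with hb
  set K : ℝ := α * (α - q) * Q / (q * A) with hK
  have ha0 : 0 < a := by positivity
  have hb0 : 0 < b := by positivity
  have hK0 : 0 < K := by positivity
  haveI : Nonempty (Set.Ioi (0 : ℝ)) := ⟨⟨1, by simp⟩⟩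
  rw [hlame] at hlam
  obtain ⟨⟨s, hs⟩, hgs⟩ := exists_lt_of_lt_ciSup hlam
  have hs : 0 < s := hs
  have hgs' : 0 < a * s ^ (p - q) - b * s ^ (γ - q) - lam := by
    have e : Λe s = a * s ^ (p - q) - b * s ^ (γ - q) := by
      have hsq : s ^ q ≠ 0 := (Real.rpow_pos_of_pos hs q).ne'
      rw [hΛe, Real.rpow_sub hs, Real.rpow_sub hs, ha, hb]
      field_simp
    simp only at hgs
    linarith
  obtain ⟨x, y, hx, hxy, gx, gy, huniq, dx, dy⟩ :=
    aux_main a b (p - q) (γ - q) lam s ha0 hb0 (by linarith) (by linarith) hlam0 hs hgs'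
  have hRd : ∀ t : ℝ, 0 < t → HasDerivAt Re
      (K * t ^ (q - α - 1) * (a * t ^ (p - q) - b * t ^ (γ - q) - lam)) t := by
    intro t ht
    have hd : HasDerivAt (fun t : ℝ => α * T / (p * A) * t ^ (p - α)
        + lam * α * Q / (q * A) * t ^ (q - α) - α * F / (γ * A) * t ^ (γ - α))
        (α * T / (p * A) * ((p - α) * t ^ (p - α - 1))
        + lam * α * Q / (q * A) * ((q - α) * t ^ (q - α - 1))
        - α * F / (γ * A) * ((γ - α) * t ^ (γ - α - 1))) t :=
      (((Real.hasDerivAt_rpow_const (Or.inl ht.ne')).const_mul _).add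
        ((Real.hasDerivAt_rpow_const (Or.inl ht.ne')).const_mul _)).sub
        ((Real.hasDerivAt_rpow_const (Or.inl ht.ne')).const_mul _)
    have he : Re =ᶠ[nhds t] (fun t : ℝ => α * T / (p * A) * t ^ (p - α)
        + lam * α * Q / (q * A) * t ^ (q - α) - α * F / (γ * A) * t ^ (γ - α)) := by
      filter_upwards [lt_mem_nhds ht] with u hu
      have huα : u ^ α ≠ 0 := (Real.rpow_pos_of_pos hu α).ne'
      rw [hRe, Real.rpow_sub hu, Real.rpow_sub hu, Real.rpow_sub hu]
      field_simp
    refine (hd.congr_of_eventuallyEq he).congr_deriv ?_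
    have e1 : t ^ (p - α - 1) = t ^ (q - α - 1) * t ^ (p - q) := by
      rw [← Real.rpow_add ht]; congr 1; ring
    have e2 : t ^ (γ - α - 1) = t ^ (q - α - 1) * t ^ (γ - q) := by
      rw [← Real.rpow_add ht]; congr 1; ring
    rw [e1, e2, ha, hb, hK]
    field_simp
    ring
  have hR2 : ∀ t : ℝ, 0 < t → a * t ^ (p - q) - b * t ^ (γ - q) - lam = 0 →
      deriv (deriv Re) t = K * t ^ (q - α - 1) *
        (t ^ (p - q - 1) * (a * (p - q) - b * (γ - q) * t ^ (γ - q - (p - q)))) := by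
    intro t ht h0
    have he : deriv Re =ᶠ[nhds t] fun t =>
        K * t ^ (q - α - 1) * (a * t ^ (p - q) - b * t ^ (γ - q) - lam) := by
      filter_upwards [lt_mem_nhds ht] with u hu
      exact (hRd u hu).deriv
    rw [he.deriv_eq]
    have hd := ((Real.hasDerivAt_rpow_const (x := t) (p := q - α - 1)
      (Or.inl ht.ne')).const_mul K).mul (aux_deriv a b (p - q) (γ - q) lam t ht)
    refine hd.deriv.trans ?_
    rw [h0]; ring
  have hy := hx.trans hxy
  refine ⟨x, y, hx, hxy, ?_, ?_, ?_, ?_, ?_⟩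
  · rw [(hRd x hx).deriv, gx, mul_zero]
  · rw [(hRd y hy).deriv, gy, mul_zero]
  · intro t ht h0
    rw [(hRd t ht).deriv] at h0
    exact huniq t ht ((mul_eq_zero.1 h0).resolve_left (by positivity))
  · rw [hR2 x hx gx]
    exact mul_pos (by positivity) dx
  · rw [hR2 y hy gy]
    exact mul_neg_of_pos_of_neg (by positivity) dy
end

section
/- Let 1 < q < α < p < γ be real numbers and T, Q, F > 0. Define Λⁿ(t) = ((p−α)·t^p·T − (γ−α)·t^γ·F)/((α−q)·t^q·Q) and Λ^e(t) = q·((p−α)·t^p·T/p − (γ−α)·t^γ·F/γ)/((α−q)·t^q·Q) for t > 0. Then for t > 0 one has Λ^e(t) = Λⁿ(t) if and only if t = t^e := (C_e·T/F)^{1/(γ−p)}, where C_e = γ(p−α)(p−q)/(p(γ−α)(γ−q)); moreover t^e is the unique critical point of Λ^e on (0,∞) and Λ^e attains its global maximum over (0,∞) at t^e. -/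
/-- Item (i) of Lemma 4.4 together with formula (17): `Λ^e(t) = Λⁿ(t)` exactly at
`t = t^e = (C_e·T/F)^{1/(γ−p)}`, which is the unique critical point of `Λ^e` on `(0,∞)`
and its global maximum point. -/
theorem stmt_13 (q α p γ T Q F : ℝ)
    (hq : 1 < q) (hqα : q < α) (hαp : α < p) (hpγ : p < γ)
    (hT : 0 < T) (hQ : 0 < Q) (hF : 0 < F)
    (Λn Λe : ℝ → ℝ)
    (hΛn : Λn = fun t : ℝ =>
      ((p - α) * t ^ p * T - (γ - α) * t ^ γ * F) / ((α - q) * t ^ q * Q))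
    (hΛe : Λe = fun t : ℝ =>
      q * ((p - α) * t ^ p * T / p - (γ - α) * t ^ γ * F / γ) / ((α - q) * t ^ q * Q))
    (Ce te : ℝ)
    (hCe : Ce = γ * (p - α) * (p - q) / (p * (γ - α) * (γ - q)))
    (hte : te = (Ce * T / F) ^ (1 / (γ - p))) :
    (∀ t : ℝ, 0 < t → (Λe t = Λn t ↔ t = te)) ∧
    0 < te ∧ deriv Λe te = 0 ∧
    (∀ t : ℝ, 0 < t → deriv Λe t = 0 → t = te) ∧
    (∀ t : ℝ, 0 < t → Λe t ≤ Λe te) := by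
  have h1 : 0 < p - α := by linarith
  have h2 : 0 < γ - α := by linarith
  have h3 : 0 < γ - q := by linarith
  have h4 : 0 < p - q := by linarith
  have h5 : 0 < α - q := by linarith
  have h6 : 0 < γ - p := by linarith
  have hp0 : 0 < p := by linarith
  have hg0 : 0 < γ := by linarith
  have hq0 : 0 < q := by linarith
  have hX : 0 < Ce * T / F := by rw [hCe]; positivity
  have hte0 : 0 < te := by rw [hte]; exact Real.rpow_pos_of_pos hX _
  have htep : te ^ (γ - p) = Ce * T / F := by
    rw [hte, ← Real.rpow_mul hX.le, one_div, inv_mul_cancel₀ h6.ne', Real.rpow_one]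
  have key : ∀ t : ℝ, 0 < t → Λn t - Λe t =
      ((γ - α) * (γ - q) * F / (γ * (α - q) * Q) * (t ^ p / t ^ q)) *
        (te ^ (γ - p) - t ^ (γ - p)) := by
    intro t ht
    have hA : t ^ γ = t ^ p * t ^ (γ - p) := by
      rw [← Real.rpow_add ht]; congr 1; ring
    have a1 := (Real.rpow_pos_of_pos ht q).ne'
    rw [htep, hCe, hΛn, hΛe]
    simp only
    rw [hA]
    generalize t ^ (γ - p) = z
    generalize t ^ p = y at *
    generalize t ^ q = x at *
    field_simp
    ring
  have hK : ∀ t : ℝ, 0 < t →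
      0 < (γ - α) * (γ - q) * F / (γ * (α - q) * Q) * (t ^ p / t ^ q) := by
    intro t ht
    have := Real.rpow_pos_of_pos ht q
    have := Real.rpow_pos_of_pos ht p
    positivity
  have hd : ∀ t : ℝ, 0 < t → HasDerivAt Λe (q / t * (Λn t - Λe t)) t := by
    intro t ht
    have d1 := Real.hasDerivAt_rpow_const (x := t) (p := p) (Or.inl ht.ne')
    have d2 := Real.hasDerivAt_rpow_const (x := t) (p := γ) (Or.inl ht.ne')
    have d3 := Real.hasDerivAt_rpow_const (x := t) (p := q) (Or.inl ht.ne')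
    have a1 := (Real.rpow_pos_of_pos ht q).ne'
    have hD : (α - q) * t ^ q * Q ≠ 0 := mul_ne_zero (mul_ne_zero h5.ne' a1) hQ.ne'
    have d := ((((d1.const_mul (p - α)).mul_const T).div_const p).sub
      (((d2.const_mul (γ - α)).mul_const F).div_const γ)).const_mul q |>.div
      ((d3.const_mul (α - q)).mul_const Q) hD
    rw [hΛn, hΛe]
    refine d.congr_deriv ?_
    simp only [Pi.sub_apply]
    rw [Real.rpow_sub_one ht.ne', Real.rpow_sub_one ht.ne', Real.rpow_sub_one ht.ne']
    generalize t ^ γ = z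
    generalize t ^ p = y at *
    generalize t ^ q = x at *
    field_simp
  have hzero : ∀ t : ℝ, 0 < t → (Λn t - Λe t = 0 ↔ t = te) := by
    intro t ht
    rw [key t ht, mul_eq_zero, or_iff_right (hK t ht).ne', sub_eq_zero,
      Real.rpow_left_inj hte0.le ht.le h6.ne']
    exact eq_comm
  refine ⟨?_, hte0, ?_, ?_, ?_⟩
  · intro t ht
    rw [← hzero t ht, sub_eq_zero]
    exact eq_comm
  · rw [(hd te hte0).deriv, (hzero te hte0).2 rfl, mul_zero]
  · intro t ht h
    rw [(hd t ht).deriv, mul_eq_zero, or_iff_right (div_pos hq0 ht).ne'] at h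
    exact (hzero t ht).1 h
  · intro t ht
    rcases le_total t te with h | h
    · have hm : MonotoneOn Λe (Set.Icc t te) := by
        refine monotoneOn_of_deriv_nonneg (convex_Icc _ _)
          (fun x hx => (hd x (ht.trans_le hx.1)).continuousAt.continuousWithinAt)
          (fun x hx => ?_) (fun x hx => ?_) <;> rw [interior_Icc] at hx
        · exact (hd x (ht.trans hx.1)).differentiableAt.differentiableWithinAt
        · have hx0 := ht.trans hx.1
          rw [(hd x hx0).deriv, key x hx0]
          have := Real.rpow_le_rpow hx0.le hx.2.le h6.le
          exact mul_nonneg (div_pos hq0 hx0).le (mul_nonneg (hK x hx0).le (by linarith))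
      exact hm ⟨le_rfl, h⟩ ⟨h, le_rfl⟩ h
    · have hm : AntitoneOn Λe (Set.Icc te t) := by
        refine antitoneOn_of_deriv_nonpos (convex_Icc _ _)
          (fun x hx => (hd x (hte0.trans_le hx.1)).continuousAt.continuousWithinAt)
          (fun x hx => ?_) (fun x hx => ?_) <;> rw [interior_Icc] at hx
        · exact (hd x (hte0.trans hx.1)).differentiableAt.differentiableWithinAt
        · have hx0 := hte0.trans hx.1
          rw [(hd x hx0).deriv, key x hx0]
          have := Real.rpow_le_rpow hte0.le hx.1.le h6.le
          exact mul_nonpos_of_nonneg_of_nonpos (div_pos hq0 hx0).le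
            (mul_nonpos_of_nonneg_of_nonpos (hK x hx0).le (by linarith))
      exact hm ⟨le_rfl, h⟩ ⟨h, le_rfl⟩ h
end

section
/- Let 1 < q < α < p < γ be real numbers and T, Q, F > 0. Define Λⁿ(t) = ((p−α)·t^p·T − (γ−α)·t^γ·F)/((α−q)·t^q·Q) and Λ^e(t) = q·((p−α)·t^p·T/p − (γ−α)·t^γ·F/γ)/((α−q)·t^q·Q) for t > 0. Then 0 < sup_{t>0} Λ^e(t) < sup_{t>0} Λⁿ(t) < +∞. -/
/-- Fiberwise version of item (1°) of Lemma 4.5: `0 < λ^e < λⁿ < +∞`, where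
`λ^e = sup_{t>0} Λ^e(t)` and `λⁿ = sup_{t>0} Λⁿ(t)` (suprema taken in the extended reals). -/
theorem stmt_16 (q α p γ T Q F : ℝ)
    (hq : 1 < q) (hqα : q < α) (hαp : α < p) (hpγ : p < γ)
    (hT : 0 < T) (hQ : 0 < Q) (hF : 0 < F)
    (Λn Λe : ℝ → ℝ)
    (hΛn : Λn = fun t : ℝ =>
      ((p - α) * t ^ p * T - (γ - α) * t ^ γ * F) / ((α - q) * t ^ q * Q))
    (hΛe : Λe = fun t : ℝ =>
      q * ((p - α) * t ^ p * T / p - (γ - α) * t ^ γ * F / γ) / ((α - q) * t ^ q * Q)) :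
    (0 : EReal) < (⨆ t : Set.Ioi (0 : ℝ), ((Λe (t : ℝ) : ℝ) : EReal)) ∧
    (⨆ t : Set.Ioi (0 : ℝ), ((Λe (t : ℝ) : ℝ) : EReal)) <
      (⨆ t : Set.Ioi (0 : ℝ), ((Λn (t : ℝ) : ℝ) : EReal)) ∧
    (⨆ t : Set.Ioi (0 : ℝ), ((Λn (t : ℝ) : ℝ) : EReal)) < ⊤ := by
  have hq0 : 0 < q := by linarith
  have hp0 : 0 < p := by linarith
  have hγ0 : 0 < γ := by linarith
  obtain ⟨a, ha⟩ : ∃ a, a = p - q := ⟨_, rfl⟩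
  obtain ⟨b, hb⟩ : ∃ b, b = γ - q := ⟨_, rfl⟩
  have ha0 : 0 < a := by linarith
  have hab : a < b := by linarith
  have hb0 : 0 < b := by linarith
  have hαq : 0 < α - q := by linarith
  obtain ⟨A, hA⟩ : ∃ A, A = (p - α) * T / ((α - q) * Q) := ⟨_, rfl⟩
  obtain ⟨B, hB⟩ : ∃ B, B = (γ - α) * F / ((α - q) * Q) := ⟨_, rfl⟩
  have hA0 : 0 < A := by
    rw [hA]; exact div_pos (mul_pos (by linarith) hT) (mul_pos hαq hQ)
  have hB0 : 0 < B := by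
    rw [hB]; exact div_pos (mul_pos (by linarith) hF) (mul_pos hαq hQ)
  have hn : ∀ t : ℝ, 0 < t → Λn t = A * t ^ a - B * t ^ b := by
    intro t ht
    have h0 : 0 < t ^ q := Real.rpow_pos_of_pos ht q
    rw [hΛn, ha, hb, Real.rpow_sub ht, Real.rpow_sub ht, hA, hB]
    field_simp
  have he : ∀ t : ℝ, 0 < t → Λe t = q / p * A * t ^ a - q / γ * B * t ^ b := by
    intro t ht
    have h0 : 0 < t ^ q := Real.rpow_pos_of_pos ht q
    rw [hΛe, ha, hb, Real.rpow_sub ht, Real.rpow_sub ht, hA, hB]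
    field_simp
  have hsplit : ∀ t : ℝ, 0 < t → t ^ b = t ^ a * t ^ (b - a) := by
    intro t ht
    rw [← Real.rpow_add ht]; congr 1; ring
  have hba : 0 < b - a := by linarith
  -- positivity of Λe somewhere
  obtain ⟨t1, ht1, hpos⟩ : ∃ t : ℝ, 0 < t ∧ 0 < Λe t := by
    have hC : 0 < q / p * A := by positivity
    have hD : 0 < q / γ * B := by positivity
    have hr : 0 < q / p * A / (2 * (q / γ * B)) := by positivity
    refine ⟨(q / p * A / (2 * (q / γ * B))) ^ (b - a)⁻¹, Real.rpow_pos_of_pos hr _, ?_⟩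
    have h1 := Real.rpow_pos_of_pos hr (b - a)⁻¹
    rw [he _ h1, hsplit _ h1, Real.rpow_inv_rpow hr.le hba.ne']
    have h2 := Real.rpow_pos_of_pos h1 a
    generalize ((q / p * A / (2 * (q / γ * B))) ^ (b - a)⁻¹) ^ a = y at h2 ⊢
    have : q / p * A * y - q / γ * B * (y * (q / p * A / (2 * (q / γ * B)))) = q / p * A * y / 2 := by
      field_simp
      ring
    rw [this]; positivity
  -- upper bound of Λn
  obtain ⟨M, hM⟩ : ∃ M : ℝ, ∀ t : ℝ, 0 < t → Λn t ≤ M := by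
    have hr : 0 < A / B := by positivity
    have h1 := Real.rpow_pos_of_pos hr (b - a)⁻¹
    refine ⟨A * ((A / B) ^ (b - a)⁻¹) ^ a, fun t ht => ?_⟩
    have hta := Real.rpow_pos_of_pos ht a
    have htb := Real.rpow_pos_of_pos ht b
    rw [hn t ht]
    rcases le_total t ((A / B) ^ (b - a)⁻¹) with h | h
    · have h3 : t ^ a ≤ ((A / B) ^ (b - a)⁻¹) ^ a := Real.rpow_le_rpow ht.le h ha0.le
      have := mul_le_mul_of_nonneg_left h3 hA0.le
      have := mul_pos hB0 htb
      linarith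
    · have h3 := Real.rpow_le_rpow h1.le h hba.le
      rw [Real.rpow_inv_rpow hr.le hba.ne', div_le_iff₀ hB0] at h3
      have h4 : 0 ≤ A * ((A / B) ^ (b - a)⁻¹) ^ a := by positivity
      rw [hsplit t ht]
      have := mul_le_mul_of_nonneg_left h3 hta.le
      nlinarith
  -- scaling
  obtain ⟨k, hk, hscale⟩ : ∃ k : ℝ, 1 < k ∧ ∀ t : ℝ, 0 < t → ∃ r : ℝ, 0 < r ∧ k * Λe t ≤ Λn r := by
    have hr : 0 < q / γ := by positivity
    obtain ⟨s, hs⟩ : ∃ s, s = (q / γ) ^ b⁻¹ := ⟨_, rfl⟩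
    have hs0 : 0 < s := by rw [hs]; exact Real.rpow_pos_of_pos hr _
    have hsb : s ^ b = q / γ := by rw [hs]; exact Real.rpow_inv_rpow hr.le hb0.ne'
    have hsa : s ^ a = (q / γ) ^ (a / b) := by
      rw [hs, ← Real.rpow_mul hr.le]; congr 1; field_simp
    have hbern : (γ / q) ^ (a / b) < p / q := by
      have := rpow_one_add_lt_one_add_mul_self (s := b / q) (p := a / b)
        (by have : 0 < b / q := by positivity
            linarith) (by positivity) (by positivity) ((div_lt_one hb0).2 hab)
      have e1 : 1 + b / q = γ / q := by rw [hb]; field_simp; ring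
      have e2 : 1 + a / b * (b / q) = p / q := by
        have : a / b * (b / q) = a / q := by field_simp
        rw [this, ha]; field_simp; ring
      rwa [e1, e2] at this
    have hsa' : q / p < s ^ a := by
      rw [hsa, ← inv_div γ q, Real.inv_rpow (by positivity), ← inv_div p q]
      exact inv_strictAnti₀ (Real.rpow_pos_of_pos (by positivity) _) hbern
    have hqp : 0 < q / p := by positivity
    have hk : 1 < s ^ a / (q / p) := (one_lt_div hqp).2 hsa'
    refine ⟨s ^ a / (q / p), hk, fun t ht => ⟨s * t, by positivity, ?_⟩⟩
    rw [he t ht, hn _ (by positivity), Real.mul_rpow hs0.le ht.le, Real.mul_rpow hs0.le ht.le, hsb]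
    have htb := Real.rpow_pos_of_pos ht b
    have h5 : s ^ a / (q / p) * (q / p * A * t ^ a) = A * (s ^ a * t ^ a) := by field_simp
    have h6 : 0 < q / γ * B * t ^ b := by positivity
    rw [mul_sub, h5]
    nlinarith
  obtain ⟨L, hL⟩ : ∃ L : EReal, L = ⨆ t : Set.Ioi (0 : ℝ), ((Λn (t : ℝ) : ℝ) : EReal) := ⟨_, rfl⟩
  have hle : ∀ t : ℝ, 0 < t → ((Λn t : ℝ) : EReal) ≤ L := by
    intro t ht
    rw [hL]
    exact le_iSup (fun t : Set.Ioi (0 : ℝ) => ((Λn (t : ℝ) : ℝ) : EReal)) ⟨t, ht⟩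
  have hLtop : L < ⊤ := by
    refine lt_of_le_of_lt ?_ (EReal.coe_lt_top M)
    rw [hL]
    exact iSup_le fun t => EReal.coe_le_coe_iff.2 (hM t t.2)
  have hLbot : L ≠ ⊥ := by
    intro h
    have := hle 1 one_pos
    rw [h] at this
    exact absurd this (not_le.2 (EReal.bot_lt_coe _))
  rw [← hL]
  refine ⟨?_, ?_, hLtop⟩
  · exact lt_of_lt_of_le (EReal.coe_pos.2 hpos)
      (le_iSup (fun t : Set.Ioi (0 : ℝ) => ((Λe (t : ℝ) : ℝ) : EReal)) ⟨t1, ht1⟩)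
  · lift L to ℝ using ⟨hLtop.ne, hLbot⟩
    have hle' : ∀ t : ℝ, 0 < t → Λn t ≤ L := fun t ht => EReal.coe_le_coe_iff.1 (hle t ht)
    have hk0 : 0 < k := by linarith
    have hb' : ∀ t : ℝ, 0 < t → Λe t ≤ L / k := by
      intro t ht
      obtain ⟨r, hr, h⟩ := hscale t ht
      rw [le_div_iff₀ hk0]
      linarith [hle' r hr]
    have hL0 : 0 < L := by
      have := lt_of_lt_of_le hpos (hb' t1 ht1)
      exact (div_pos_iff_of_pos_right hk0).1 this
    exact lt_of_le_of_lt (iSup_le fun t => EReal.coe_le_coe_iff.2 (hb' t t.2))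
      (EReal.coe_lt_coe_iff.2 (div_lt_self hL0 hk))
end
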